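/- arXiv:1811.06739 — 3 statements merged into one kernel-verified Lean document; each statement's English description precedes it below -/
import Mathlib

section
/- For all integers m > k > 1 and every real number q with 0 < q < 1, Young's rule satisfies the (q,k,m)-majority criterion if and only if q ≥ (k−1)/k. -/
open Finset
open scoped Classical

noncomputable section

/-- A preference profile: each of the `n` voters has a ranking of the `m`
candidates, given as a bijection sending each candidate to its rank
(rank `0` is the best).  Voter `i` prefers `a` to `b` iff `P i a < P i b`. -/
abbrev Profile (m n : ℕ) := Fin n → (Fin m ≃ Fin m)

namespace Voting

variable {m n : ℕ}

/-- `h(a,b)`: the number of voters who prefer candidate `a` to candidate `b`. -/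
def pairs (P : Profile m n) (a b : Fin m) : ℕ :=
  (Finset.univ.filter fun i => P i a < P i b).card

/-- `n_1(a)`: the number of voters who rank candidate `a` first. -/
def firstCount (P : Profile m n) (a : Fin m) : ℕ :=
  (Finset.univ.filter fun i => ∀ b, b ≠ a → P i a < P i b).card

/-- `n_m(a)`: the number of voters who rank candidate `a` last. -/
def lastCount (P : Profile m n) (a : Fin m) : ℕ :=
  (Finset.univ.filter fun i => ∀ b, b ≠ a → P i b < P i a).card

/-- The number of voters who give the set `B` the top `|B|` positions. -/
def topSupporters (P : Profile m n) (B : Finset (Fin m)) : ℕ :=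
  (Finset.univ.filter fun i => ∀ a ∈ B, ∀ b ∉ B, P i a < P i b).card

/-- The `(q,k,m)`-majority criterion for a voting rule with `m` candidates:
for every number of voters `n ≥ 1`, every profile, and every `k`-element set `B`
of candidates such that strictly more than `q·n` voters give `B` the top `k`
positions, every winner belongs to `B`. -/
def MajorityCriterion (m k : ℕ) (q : ℝ)
    (rule : (n : ℕ) → Profile m n → Finset (Fin m)) : Prop :=
  ∀ n : ℕ, 1 ≤ n → ∀ P : Profile m n, ∀ B : Finset (Fin m),
    B.card = k → q * (n : ℝ) < (topSupporters P B : ℝ) → rule n P ⊆ B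

/-- The Young score of `a`: the smallest number of voters whose removal makes
`a` a weak Condorcet winner among the remaining voters. -/
def youngScore (P : Profile m n) (a : Fin m) : ℕ :=
  sInf {t : ℕ | ∃ S : Finset (Fin n), S.card = t ∧
    ∀ b, b ≠ a →
      ((Finset.univ \ S).filter fun i => P i b < P i a).card ≤
      ((Finset.univ \ S).filter fun i => P i a < P i b).card}

/-- Young's rule: the winners are the candidates with the lowest Young score. -/
def youngWinners (P : Profile m n) : Finset (Fin m) :=
  Finset.univ.filter fun a => ∀ b, youngScore P a ≤ youngScore P b

/-- `a` is a weak Condorcet winner among the voters in `K`. -/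
def IsWeakCondorcetOn (P : Profile m n) (K : Finset (Fin n)) (a : Fin m) : Prop :=
  ∀ b, b ≠ a →
    (K.filter fun i => P i b < P i a).card ≤ (K.filter fun i => P i a < P i b).card

theorem youngScore_le (P : Profile m n) {K : Finset (Fin n)} {a : Fin m}
    (h : IsWeakCondorcetOn P K a) : youngScore P a ≤ n - K.card := by
  refine Nat.sInf_le ⟨univ \ K, ?_, ?_⟩
  · rw [card_sdiff_of_subset (subset_univ K), card_univ, Fintype.card_fin]
  · rwa [Finset.sdiff_sdiff_eq_self (subset_univ K)]

theorem exists_isWeakCondorcetOn_card (P : Profile m n) (a : Fin m) :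
    ∃ K : Finset (Fin n), K.card + youngScore P a = n ∧ IsWeakCondorcetOn P K a := by
  have hne : {t : ℕ | ∃ S : Finset (Fin n), S.card = t ∧ ∀ b, b ≠ a →
      ((univ \ S).filter fun i => P i b < P i a).card ≤
      ((univ \ S).filter fun i => P i a < P i b).card}.Nonempty :=
    ⟨_, univ, rfl, by simp⟩
  obtain ⟨S, hS, h⟩ := Nat.sInf_mem hne
  refine ⟨univ \ S, ?_, h⟩
  have hle := card_le_univ S
  rw [Fintype.card_fin] at hle
  rw [card_sdiff_of_subset (subset_univ S), card_univ, Fintype.card_fin]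
  change n - S.card + sInf _ = n
  rw [← hS]
  omega

theorem card_filter_lt_add_card_filter_lt (P : Profile m n) (K : Finset (Fin n)) {a b : Fin m}
    (hab : a ≠ b) :
    (K.filter fun i => P i a < P i b).card + (K.filter fun i => P i b < P i a).card = K.card := by
  rw [← card_filter_add_card_filter_not (s := K) fun i => P i a < P i b]
  congr 2
  refine filter_congr fun i _ => ?_
  have : P i a ≠ P i b := fun h => hab ((P i).injective h)
  grind

theorem IsWeakCondorcetOn.card_le {P : Profile m n} {K : Finset (Fin n)} {a b : Fin m}
    (h : IsWeakCondorcetOn P K a) (hab : a ≠ b) :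
    K.card ≤ 2 * (K.filter fun i => P i a < P i b).card := by
  have h1 := h b hab.symm
  have h2 := card_filter_lt_add_card_filter_lt P K hab
  omega

theorem isWeakCondorcetOn_of_card_le {P : Profile m n} {K : Finset (Fin n)} {a : Fin m}
    (h : ∀ b, b ≠ a → K.card ≤ 2 * (K.filter fun i => P i a < P i b).card) :
    IsWeakCondorcetOn P K a := by
  intro b hb
  have h1 := h b hb
  have h2 := card_filter_lt_add_card_filter_lt P K hb.symm
  omega

/-- Some member of a nonempty `B` is ranked first within `B` by at least a `1 / |B|` share of the
voters. -/
theorem exists_card_le_mul_card_filter_top (P : Profile m n) {B : Finset (Fin m)}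
    (hB : B.Nonempty) :
    ∃ b ∈ B, n ≤ B.card * (univ.filter fun i => ∀ c ∈ B, c ≠ b → P i b < P i c).card := by
  have htop : ∀ i, ∃ b ∈ B, ∀ c ∈ B, P i b ≤ P i c := fun i => exists_min_image B (P i) hB
  choose f hfB hf using htop
  obtain ⟨b, hb, hle⟩ := exists_max_image B (fun b => (univ.filter fun i => f i = b).card) hB
  refine ⟨b, hb, ?_⟩
  calc n = (univ : Finset (Fin n)).card := by simp
    _ = ∑ b ∈ B, (univ.filter fun i => f i = b).card :=
      card_eq_sum_card_fiberwise fun i _ => hfB i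
    _ ≤ B.card * (univ.filter fun i => f i = b).card := by
      simpa using sum_le_card_nsmul B _ _ hle
    _ ≤ _ := by
      refine Nat.mul_le_mul_left _ (card_le_card fun i hi => ?_)
      simp only [mem_filter, mem_univ, true_and] at hi ⊢
      subst hi
      exact fun c hc hne =>
        lt_of_le_of_ne (hf i c hc) fun h => hne ((P i).injective h).symm

/-- If the non-supporters of `B` make up less than a `1 / |B|` share of the voters, where
`2 ≤ |B|`, then all Young winners belong to `B`. -/
theorem youngWinners_subset_of_mul_lt (P : Profile m n) {B : Finset (Fin m)} (hB : 2 ≤ B.card)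
    (h : B.card * (n - topSupporters P B) < n) : youngWinners P ⊆ B := by
  intro a ha
  by_contra haB
  set S : Finset (Fin n) := univ.filter fun i => ∀ a ∈ B, ∀ b ∉ B, P i a < P i b with hS
  set r := n - topSupporters P B with hr
  have hSc : Sᶜ.card = r := by rw [card_compl, Fintype.card_fin]; rfl
  obtain ⟨b, hb, hbn⟩ := exists_card_le_mul_card_filter_top P (card_pos.mp (by omega : 0 < B.card))
  set T : Finset (Fin n) := univ.filter fun i => ∀ c ∈ B, c ≠ b → P i b < P i c with hT
  have hrT : r < T.card := lt_of_mul_lt_mul_left' (h.trans_le hbn)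
  have hrn : 2 * r + 1 ≤ n := by nlinarith
  obtain ⟨T', hT'T, hT'⟩ := exists_subset_card_eq (show r + 1 ≤ T.card from hrT)
  obtain ⟨K, hT'K, -, hK⟩ := exists_subsuperset_card_eq (n := 2 * r + 1) (subset_univ T')
    (by omega) (by simpa using hrn)
  have hbK : IsWeakCondorcetOn P K b := by
    refine isWeakCondorcetOn_of_card_le fun c hcb => ?_
    suffices r + 1 ≤ (K.filter fun i => P i b < P i c).card by omega
    by_cases hc : c ∈ B
    · rw [← hT']
      refine card_le_card fun i hi => mem_filter.mpr ⟨hT'K hi, ?_⟩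
      exact (mem_filter.mp (hT'T hi)).2 c hc hcb
    · have hKS : (K \ Sᶜ).card ≤ (K.filter fun i => P i b < P i c).card := by
        refine card_le_card fun i hi => ?_
        simp only [mem_sdiff, mem_compl, not_not] at hi
        exact mem_filter.mpr ⟨hi.1, (mem_filter.mp hi.2).2 b hb c hc⟩
      have := le_card_sdiff Sᶜ K
      omega
  obtain ⟨L, hLn, hL⟩ := exists_isWeakCondorcetOn_card P a
  have hLb := hL.card_le (b := b) (by rintro rfl; exact haB hb)
  have hLr : (L.filter fun i => P i a < P i b).card ≤ r := by
    rw [← hSc]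
    refine card_le_card fun i hi => mem_compl.mpr fun hiS => ?_
    exact (mem_filter.mp hi).2.asymm ((mem_filter.mp hiS).2 b hb a haB)
  have hba := youngScore_le P hbK
  have hab : youngScore P a ≤ youngScore P b := (mem_filter.mp ha).2 b
  omega

/-- The ranks used by voter `i` in a profile with `k` voters: voter `i` ranks the candidates below
`k` in the cyclic order starting at `i`, followed by the others in increasing order, except that
voter `0` moves candidate `k` to the top. -/
def cyclicRank (k i c : ℕ) : ℕ :=
  if c < k then if i = 0 then c + 1 else if i ≤ c then c - i else c + k - i
  else if c = k ∧ i = 0 then 0 else c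

theorem cyclicRank_lt {m k i c : ℕ} (hkm : k < m) (hc : c < m) : cyclicRank k i c < m := by
  unfold cyclicRank
  split_ifs <;> omega

theorem cyclicRank_injective {k i : ℕ} (hi : i < k) : Function.Injective (cyclicRank k i) := by
  intro c d h
  unfold cyclicRank at h
  split_ifs at h <;> omega

def cyclicProfile {m k : ℕ} (hkm : k < m) : Profile m k := fun i =>
  Equiv.ofBijective (fun c => ⟨cyclicRank k i c, cyclicRank_lt hkm c.isLt⟩)
    (Finite.injective_iff_bijective.mp fun _ _ h =>
      Fin.ext (cyclicRank_injective i.isLt (congrArg Fin.val h)))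

theorem cyclicProfile_lt_iff {m k : ℕ} (hkm : k < m) (i : Fin k) (c d : Fin m) :
    cyclicProfile hkm i c < cyclicProfile hkm i d ↔ cyclicRank k i c < cyclicRank k i d :=
  Iff.rfl

theorem youngScore_cyclicProfile_le {m k : ℕ} (hk : 1 < k) (hkm : k < m) :
    youngScore (cyclicProfile hkm) ⟨k, hkm⟩ ≤ k - 2 := by
  have hcard : ({⟨0, by omega⟩, ⟨1, hk⟩} : Finset (Fin k)).card = 2 := card_pair (by simp)
  rw [← hcard]
  refine youngScore_le _ (isWeakCondorcetOn_of_card_le fun b hb => ?_)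
  rw [hcard]
  suffices 0 < (({⟨0, by omega⟩, ⟨1, hk⟩} : Finset (Fin k)).filter fun i =>
      cyclicProfile hkm i ⟨k, hkm⟩ < cyclicProfile hkm i b).card by omega
  refine card_pos.mpr ⟨⟨0, by omega⟩, mem_filter.mpr ⟨by simp, ?_⟩⟩
  rw [cyclicProfile_lt_iff]
  have hbk : b.val ≠ k := fun h => hb (Fin.ext h)
  dsimp only [cyclicRank]
  split_ifs <;> omega

theorem le_youngScore_cyclicProfile {m k : ℕ} (hk : 1 < k) (hkm : k < m) (b : Fin m)
    (hb : b ≠ ⟨k, hkm⟩) : k - 2 ≤ youngScore (cyclicProfile hkm) b := by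
  obtain ⟨K, hKk, hK⟩ := exists_isWeakCondorcetOn_card (cyclicProfile hkm) b
  have hbk : b.val ≠ k := fun h => hb (Fin.ext h)
  suffices K.card ≤ 2 by omega
  obtain ⟨c, hbc, hc⟩ : ∃ c : Fin m, b ≠ c ∧
      ∀ i j : Fin k, cyclicProfile hkm i b < cyclicProfile hkm i c →
        cyclicProfile hkm j b < cyclicProfile hkm j c → i = j := by
    simp only [cyclicProfile_lt_iff, cyclicRank, Fin.ext_iff, ne_eq]
    rcases lt_trichotomy b.val k with hlt | heq | hgt
    · rcases Nat.eq_zero_or_pos b.val with h0 | h0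
      · refine ⟨⟨k - 1, by omega⟩, by dsimp only; omega, fun i j hi hj => ?_⟩
        dsimp only at hi hj
        trans 0 <;> [skip; symm] <;> split_ifs at hi hj <;> omega
      · refine ⟨⟨b - 1, by omega⟩, by dsimp only; omega, fun i j hi hj => ?_⟩
        dsimp only at hi hj
        trans b.val <;> [skip; symm] <;> split_ifs at hi hj <;> omega
    · exact absurd heq hbk
    · refine ⟨⟨k, hkm⟩, hbk, fun i j hi => ?_⟩
      dsimp only at hi
      split_ifs at hi <;> omega
  have h1 := hK.card_le hbc
  have h2 : (K.filter fun i => cyclicProfile hkm i b < cyclicProfile hkm i c).card ≤ 1 :=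
    card_le_one.mpr fun i hi j hj => hc i j (mem_filter.mp hi).2 (mem_filter.mp hj).2
  omega

theorem mem_youngWinners_cyclicProfile {m k : ℕ} (hk : 1 < k) (hkm : k < m) :
    ⟨k, hkm⟩ ∈ youngWinners (cyclicProfile hkm) := by
  refine mem_filter.mpr ⟨mem_univ _, fun b => ?_⟩
  by_cases hb : b = ⟨k, hkm⟩
  · rw [hb]
  · exact (youngScore_cyclicProfile_le hk hkm).trans (le_youngScore_cyclicProfile hk hkm b hb)

theorem le_topSupporters_cyclicProfile {m k : ℕ} (hk : 1 < k) (hkm : k < m) :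
    k - 1 ≤ topSupporters (cyclicProfile hkm) (Iio ⟨k, hkm⟩) := by
  have hcard : (univ.erase (⟨0, by omega⟩ : Fin k)).card = k - 1 := by simp
  rw [← hcard]
  refine card_le_card fun i hi => mem_filter.mpr ⟨mem_univ _, fun a ha b hb => ?_⟩
  have hi0 : i.val ≠ 0 := fun h => ne_of_mem_erase hi (Fin.ext h)
  simp only [mem_Iio, Fin.lt_def] at ha hb
  rw [cyclicProfile_lt_iff]
  simp only [cyclicRank]
  split_ifs <;> omega

/-- For all integers `m > k > 1` and every real `q` with `0 < q < 1`, Young's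
rule satisfies the `(q,k,m)`-majority criterion iff `q ≥ (k−1)/k`. -/
theorem young_qkm_majority (m k : ℕ) (hk : 1 < k) (hmk : k < m)
    (q : ℝ) (hq0 : 0 < q) (hq1 : q < 1) :
    MajorityCriterion m k q (fun n P => youngWinners P) ↔
      ((k : ℝ) - 1) / (k : ℝ) ≤ q := by
  have hk0 : (0 : ℝ) < k := by positivity
  constructor
  · intro h
    by_contra! hq
    have hsub : (youngWinners (cyclicProfile hmk)) ⊆ Iio ⟨k, hmk⟩ := by
      refine h k hk.le (cyclicProfile hmk) (Iio ⟨k, hmk⟩) (by simp) ?_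
      have hle : ((k - 1 : ℕ) : ℝ) ≤ topSupporters (cyclicProfile hmk) (Iio ⟨k, hmk⟩) := by
        exact_mod_cast le_topSupporters_cyclicProfile hk hmk
      rw [Nat.cast_pred (by omega)] at hle
      exact ((lt_div_iff₀ hk0).mp hq).trans_le hle
    exact lt_irrefl _ (mem_Iio.mp (hsub (mem_youngWinners_cyclicProfile hk hmk)))
  · intro hq n hn P B hB hlt
    refine youngWinners_subset_of_mul_lt P (by omega) ?_
    have hle : topSupporters P B ≤ n := by
      simpa [topSupporters] using card_le_univ
        (univ.filter fun i => ∀ a ∈ B, ∀ b ∉ B, P i a < P i b)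
    rw [hB, ← Nat.cast_lt (α := ℝ), Nat.cast_mul, Nat.cast_sub hle]
    rw [div_le_iff₀ hk0] at hq
    have hn0 : (0 : ℝ) ≤ n := n.cast_nonneg
    nlinarith [mul_le_mul_of_nonneg_right hq hn0, mul_lt_mul_of_pos_right hlt hk0]

end Voting
end
end

section
/- For all integers k ≥ 1 and m = k+1, and every real number q with 0 < q < 1, the plurality with runoff rule satisfies the (q,k,m)-majority criterion if and only if q ≥ 1/2. -/
open Finset
open scoped Classical

noncomputable section

namespace Voting

variable {m n : ℕ}

/-- The plurality with runoff rule: `w` wins iff for some `z ≠ w`, `w` and `z`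
have the two highest numbers of first positions and `h(w,z) ≥ h(z,w)`. -/
def runoffWinners (P : Profile m n) : Finset (Fin m) :=
  Finset.univ.filter fun w => ∃ z, z ≠ w ∧
    (∀ x, x ≠ w → x ≠ z → firstCount P x ≤ firstCount P w ∧
      firstCount P x ≤ firstCount P z) ∧
    pairs P z w ≤ pairs P w z

/-- If `c` beats or ties `z` pairwise, at most half of the voters prefer `z` to `c`. -/
lemma two_mul_le_of_pairs_le (P : Profile m n) {c z : Fin m}
    (h : pairs P z c ≤ pairs P c z) : 2 * pairs P z c ≤ n := by
  have hdisj : Disjoint (univ.filter fun i => P i z < P i c)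
      (univ.filter fun i => P i c < P i z) :=
    disjoint_filter.2 fun _ _ h₁ h₂ => lt_asymm h₁ h₂
  have hcard := card_le_univ ((univ.filter fun i => P i z < P i c) ∪
      (univ.filter fun i => P i c < P i z))
  rw [card_union_of_disjoint hdisj, Fintype.card_fin] at hcard
  unfold pairs at *
  omega

/-- Every supporter of `B` prefers each candidate in `B` to each candidate outside `B`. -/
lemma topSupporters_le_pairs (P : Profile m n) {B : Finset (Fin m)} {c z : Fin m}
    (hc : c ∉ B) (hz : z ∈ B) : topSupporters P B ≤ pairs P z c :=
  card_le_card fun i hi => by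
    simp only [mem_filter, mem_univ, true_and] at hi ⊢
    exact hi z hz c hc

/-- The two-voter profile in which the voters have opposite preferences. -/
def oppositeProfile (m : ℕ) : Profile m 2 := ![Equiv.refl _, Fin.revPerm]

lemma topSupporters_oppositeProfile (k : ℕ) :
    1 ≤ topSupporters (oppositeProfile (k + 1)) (univ.erase 0) := by
  refine card_pos.2 ⟨1, ?_⟩
  simp only [oppositeProfile, mem_filter, mem_univ, true_and, mem_erase, and_true, not_not]
  rintro a ha _ rfl
  exact Fin.rev_lt_rev.2 (Fin.pos_iff_ne_zero.2 ha)

lemma zero_mem_runoffWinners_oppositeProfile {k : ℕ} (hk : 1 ≤ k) :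
    (0 : Fin (k + 1)) ∈ runoffWinners (oppositeProfile (k + 1)) := by
  have hlast : Fin.last k ≠ 0 := by
    simp [Fin.ext_iff]
    omega
  simp only [runoffWinners, mem_filter, mem_univ, true_and]
  refine ⟨Fin.last k, hlast, fun x hx₀ hxl => ?_, ?_⟩
  · have hx : firstCount (oppositeProfile (k + 1)) x = 0 := by
      refine card_eq_zero.2 (filter_eq_empty_iff.2 fun i _ h => ?_)
      fin_cases i
      · simpa [oppositeProfile] using h 0 hx₀.symm
      · simpa [oppositeProfile] using (h _ hxl.symm).trans_le (Fin.rev_le_rev.2 (Fin.le_last x))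
    simp [hx]
  · simp only [pairs, card_filter, Fin.sum_univ_two]
    simp [oppositeProfile, Fin.pos_iff_ne_zero.2 hlast]

/-- For all integers `k ≥ 1` and `m = k + 1`, and every real `q` with
`0 < q < 1`, the plurality with runoff rule satisfies the `(q,k,m)`-majority
criterion iff `q ≥ 1/2`. -/
theorem runoff_qkm_majority_top (m k : ℕ) (hk : 1 ≤ k) (hm : m = k + 1)
    (q : ℝ) (hq0 : 0 < q) (hq1 : q < 1) :
    MajorityCriterion m k q (fun n P => runoffWinners P) ↔
      (1 : ℝ) / 2 ≤ q := by
  subst hm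
  constructor
  · intro h
    by_contra! hq
    have hsupp : (1 : ℝ) ≤ topSupporters (oppositeProfile (k + 1)) (univ.erase 0) := by
      exact_mod_cast topSupporters_oppositeProfile k
    have hsub := h 2 (by norm_num) (oppositeProfile (k + 1)) (univ.erase 0) (by simp)
      (by push_cast; linarith)
    exact notMem_erase _ _ (hsub (zero_mem_runoffWinners_oppositeProfile hk))
  · intro hq n _ P B hB hlt c hc
    by_contra hcB
    simp only [runoffWinners, mem_filter, mem_univ, true_and] at hc
    obtain ⟨z, hzc, -, hpairs⟩ := hc
    have hcompl : Bᶜ.card ≤ 1 := by simp [card_compl, hB]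
    have hzB : z ∈ B := by
      by_contra hzB
      exact hzc (card_le_one.1 hcompl z (mem_compl.2 hzB) c (mem_compl.2 hcB))
    have hle : (2 * topSupporters P B : ℝ) ≤ n := by
      exact_mod_cast (Nat.mul_le_mul_left 2 (topSupporters_le_pairs P hcB hzB)).trans
        (two_mul_le_of_pairs_le P hpairs)
    nlinarith [(Nat.cast_nonneg n : (0 : ℝ) ≤ n)]

end Voting
end
end

section
/- For all integers m > k ≥ 1 and every real number q with q ≥ k/(k+1), Dodgson's rule satisfies the (q,k,m)-majority criterion. -/
open Finset
open scoped Classical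

noncomputable section

namespace Voting

variable {m n : ℕ}

/-- `a` is a Condorcet winner: `h(a,b) > n/2` for every `b ≠ a`. -/
def CondorcetWinner (P : Profile m n) (a : Fin m) : Prop :=
  ∀ b, b ≠ a → (n : ℝ) / 2 < (pairs P a b : ℝ)

/-- `Q` is obtained from `P` by one exchange of adjacent candidates in one
voter's preference order. -/
def AdjacentStep (P Q : Profile m n) : Prop :=
  ∃ i : Fin n, ∃ r s : Fin m, (r : ℕ) + 1 = (s : ℕ) ∧
    Q i = (P i).trans (Equiv.swap r s) ∧ ∀ j, j ≠ i → Q j = P j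

/-- `Q` is obtained from `P` by `s` sequential adjacent exchanges. -/
def Reachable (s : ℕ) (P Q : Profile m n) : Prop :=
  ∃ f : ℕ → Profile m n, f 0 = P ∧ f s = Q ∧ ∀ t < s, AdjacentStep (f t) (f (t + 1))

/-- The Dodgson score of `a`: the smallest number of sequential adjacent
exchanges after which `a` becomes a Condorcet winner. -/
def dodgsonScore (P : Profile m n) (a : Fin m) : ℕ :=
  sInf {s : ℕ | ∃ Q : Profile m n, Reachable s P Q ∧ CondorcetWinner Q a}

/-- Dodgson's rule: the winners are the candidates with the smallest Dodgson
score. -/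
def dodgsonWinners (P : Profile m n) : Finset (Fin m) :=
  Finset.univ.filter fun a => ∀ b, dodgsonScore P a ≤ dodgsonScore P b

theorem Reachable.refl (P : Profile m n) : Reachable 0 P P :=
  ⟨fun _ => P, rfl, rfl, fun _ ht => absurd ht (Nat.not_lt_zero _)⟩

theorem Reachable.step {s : ℕ} {P Q R : Profile m n} (h : Reachable s P Q)
    (hQR : AdjacentStep Q R) : Reachable (s + 1) P R := by
  obtain ⟨f, h0, hs, hf⟩ := h
  refine ⟨fun t => if t ≤ s then f t else R, by simp [h0], by simp, fun t ht => ?_⟩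
  rcases Nat.lt_succ_iff_lt_or_eq.mp ht with hlt | rfl
  · simpa [hlt.le, Nat.succ_le_of_lt hlt] using hf t hlt
  · simpa [hs] using hQR

theorem Reachable.trans {s t : ℕ} {P Q R : Profile m n} (h : Reachable s P Q)
    (h' : Reachable t Q R) : Reachable (s + t) P R := by
  induction t generalizing R with
  | zero =>
    obtain ⟨f, h0, ht, -⟩ := h'
    rwa [← ht, h0]
  | succ t ih =>
    obtain ⟨f, h0, ht, hf⟩ := h'
    have hprev : Reachable t Q (f t) := ⟨f, h0, rfl, fun u hu => hf u (hu.trans t.lt_succ_self)⟩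
    exact (ih hprev).step (ht ▸ hf t t.lt_succ_self)

/-- A voter's candidate at rank `r` can be moved to the top by `r` adjacent exchanges. -/
theorem exists_reachable_top_voter (P : Profile m n) (i : Fin n) (a : Fin m) :
    ∃ Q, Reachable (P i a : ℕ) P Q ∧ (Q i a : ℕ) = 0 ∧ ∀ j, j ≠ i → Q j = P j := by
  obtain ⟨r, hr⟩ : ∃ r : ℕ, (P i a : ℕ) = r := ⟨_, rfl⟩
  rw [hr]
  induction r generalizing P with
  | zero => exact ⟨P, .refl P, hr, fun _ _ => rfl⟩
  | succ r ih =>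
    have hrm : r < m := by have := (P i a).isLt; omega
    let P' : Profile m n := Function.update P i ((P i).trans (Equiv.swap ⟨r, hrm⟩ (P i a)))
    have hstep : AdjacentStep P P' :=
      ⟨i, ⟨r, hrm⟩, P i a, hr.symm, by simp [P'], fun j hj => by simp [P', hj]⟩
    obtain ⟨Q, hQ, hQa, hQj⟩ := ih P' (by simp [P'])
    refine ⟨Q, ?_, hQa, fun j hj => by rw [hQj j hj]; simp [P', hj]⟩
    have := ((Reachable.refl P).step hstep).trans hQ
    rwa [zero_add, add_comm] at this

/-- A candidate can be moved to the top for all voters in `S` by as many adjacent exchanges as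
the sum of its ranks over `S`. -/
theorem exists_reachable_top (P : Profile m n) (S : Finset (Fin n)) (a : Fin m) :
    ∃ Q, Reachable (∑ i ∈ S, (P i a : ℕ)) P Q ∧ (∀ i ∈ S, (Q i a : ℕ) = 0) ∧
      ∀ j, j ∉ S → Q j = P j := by
  induction S using Finset.induction_on with
  | empty => exact ⟨P, by simpa using Reachable.refl P, by simp, fun _ _ => rfl⟩
  | insert i S hi ih =>
    obtain ⟨Q, hQ, hQS, hQj⟩ := ih
    obtain ⟨R, hR, hRi, hRj⟩ := exists_reachable_top_voter Q i a
    refine ⟨R, ?_, fun j hj => ?_, fun j hj => ?_⟩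
    · rw [sum_insert hi, add_comm, ← hQj i hi]
      exact hQ.trans hR
    · by_cases hji : j = i
      · rw [hji, hRi]
      · rw [hRj j hji]
        exact hQS j ((mem_insert.mp hj).resolve_left hji)
    · rw [mem_insert, not_or] at hj
      rw [hRj j hj.1, hQj j hj.2]

theorem condorcetWinner_of_top {Q : Profile m n} {S : Finset (Fin n)} {a : Fin m}
    (hS : n < 2 * S.card) (hQ : ∀ i ∈ S, (Q i a : ℕ) = 0) : CondorcetWinner Q a := by
  intro b hb
  have hle : S.card ≤ pairs Q a b := by
    refine card_le_card fun i hi => ?_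
    have hne : (Q i b : ℕ) ≠ Q i a := fun h => hb ((Q i).injective (Fin.ext h))
    have h0 := hQ i hi
    simp only [mem_filter, mem_univ, true_and, Fin.lt_def]
    omega
  have h : (n : ℝ) < 2 * (pairs Q a b : ℝ) := by
    exact_mod_cast hS.trans_le (Nat.mul_le_mul_left 2 hle)
  linarith

theorem dodgsonScore_le_sum_rank (P : Profile m n) {S : Finset (Fin n)} (a : Fin m)
    (hS : n < 2 * S.card) : dodgsonScore P a ≤ ∑ i ∈ S, (P i a : ℕ) := by
  obtain ⟨Q, hQ, hQS, -⟩ := exists_reachable_top P S a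
  exact Nat.sInf_le ⟨Q, hQ, condorcetWinner_of_top hS hQS⟩

theorem exists_reachable_dodgsonScore (hn : 1 ≤ n) (P : Profile m n) (a : Fin m) :
    ∃ Q, Reachable (dodgsonScore P a) P Q ∧ CondorcetWinner Q a := by
  obtain ⟨Q, hQ, hQS, -⟩ := exists_reachable_top P univ a
  have hne : {s : ℕ | ∃ Q : Profile m n, Reachable s P Q ∧ CondorcetWinner Q a}.Nonempty :=
    ⟨_, Q, hQ, condorcetWinner_of_top (by simp; omega) hQS⟩
  exact Nat.sInf_mem hne

theorem sum_pairs_eq (P : Profile m n) (a : Fin m) (B : Finset (Fin m)) :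
    ∑ b ∈ B, pairs P a b = ∑ i, (B.filter fun b => P i a < P i b).card := by
  simp only [pairs, card_filter]
  exact sum_comm

/-- An adjacent exchange moves a candidate past at most one other candidate. -/
theorem AdjacentStep.sum_pairs_le {P Q : Profile m n} (h : AdjacentStep P Q) (a : Fin m)
    (B : Finset (Fin m)) : ∑ b ∈ B, pairs Q a b ≤ ∑ b ∈ B, pairs P a b + 1 := by
  obtain ⟨i, r, s, hrs, hi, hj⟩ := h
  rw [sum_pairs_eq, sum_pairs_eq, ← add_sum_erase _ _ (mem_univ i),
    ← add_sum_erase _ _ (mem_univ i)]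
  have hrest : ∑ j ∈ univ.erase i, (B.filter fun b => Q j a < Q j b).card =
      ∑ j ∈ univ.erase i, (B.filter fun b => P j a < P j b).card :=
    sum_congr rfl fun j hji => by rw [hj j (ne_of_mem_erase hji)]
  have hsub : (B.filter fun b => Q i a < Q i b) ⊆
      insert ((P i).symm r) (B.filter fun b => P i a < P i b) := by
    intro b hb
    rw [mem_filter, hi] at hb
    obtain ⟨hbB, hlt⟩ := hb
    simp only [Equiv.trans_apply, Equiv.swap_apply_def] at hlt
    rw [mem_insert, mem_filter, Equiv.eq_symm_apply]
    refine or_iff_not_imp_left.mpr fun hbr => ⟨hbB, ?_⟩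
    simp only [Fin.lt_def, Fin.ext_iff] at *
    split_ifs at hlt <;> omega
  have := (card_le_card hsub).trans (card_insert_le _ _)
  omega

theorem Reachable.sum_pairs_le {s : ℕ} {P Q : Profile m n} (h : Reachable s P Q) (a : Fin m)
    (B : Finset (Fin m)) : ∑ b ∈ B, pairs Q a b ≤ ∑ b ∈ B, pairs P a b + s := by
  obtain ⟨f, rfl, rfl, hf⟩ := h
  induction s with
  | zero => simp
  | succ s ih =>
    have h1 := ih fun t ht => hf t (ht.trans s.lt_succ_self)
    have h2 := (hf s s.lt_succ_self).sum_pairs_le a B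
    omega

theorem CondorcetWinner.card_mul_le_sum_pairs {Q : Profile m n} {a : Fin m}
    (h : CondorcetWinner Q a) {B : Finset (Fin m)} (ha : a ∉ B) :
    B.card * (n / 2 + 1) ≤ ∑ b ∈ B, pairs Q a b := by
  rw [← smul_eq_mul]
  refine card_nsmul_le_sum _ _ _ fun b hb => ?_
  have hlt := h b fun hba => ha (hba ▸ hb)
  have : n < 2 * pairs Q a b := by
    have : (n : ℝ) < 2 * (pairs Q a b : ℝ) := by linarith
    exact_mod_cast this
  omega

theorem pairs_add_topSupporters_le (P : Profile m n) {a b : Fin m} {B : Finset (Fin m)}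
    (ha : a ∉ B) (hb : b ∈ B) : pairs P a b + topSupporters P B ≤ n := by
  rw [pairs, topSupporters, ← card_union_of_disjoint]
  · exact (card_le_univ _).trans_eq (Fintype.card_fin n)
  · rw [disjoint_filter]
    exact fun i _ hab htop => lt_asymm hab (htop b hb a ha)

theorem sum_pairs_add_le (P : Profile m n) {a : Fin m} {B : Finset (Fin m)} (ha : a ∉ B) :
    ∑ b ∈ B, pairs P a b + B.card * topSupporters P B ≤ B.card * n := by
  rw [← smul_eq_mul, ← sum_const, ← sum_add_distrib, ← smul_eq_mul (a := B.card) (b := n)]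
  exact sum_le_card_nsmul _ _ _ fun b hb => pairs_add_topSupporters_le P ha hb

/-- Lower bound for the Dodgson score of a candidate outside `B`. -/
theorem card_mul_le_dodgsonScore (hn : 1 ≤ n) (P : Profile m n) {a : Fin m}
    {B : Finset (Fin m)} (ha : a ∉ B) :
    B.card * (n / 2 + 1) + B.card * topSupporters P B ≤ B.card * n + dodgsonScore P a := by
  obtain ⟨Q, hQ, hw⟩ := exists_reachable_dodgsonScore hn P a
  have h1 := hw.card_mul_le_sum_pairs ha
  have h2 := hQ.sum_pairs_le a B
  have h3 := sum_pairs_add_le P ha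
  omega

/-- If `B` occupies the top positions of a ranking, its ranks sum to at most
`0 + 1 + ⋯ + (|B| - 1)`. -/
theorem two_mul_sum_rank_le (σ : Fin m ≃ Fin m) {B : Finset (Fin m)}
    (h : ∀ a ∈ B, ∀ b ∉ B, σ a < σ b) :
    2 * ∑ b ∈ B, (σ b : ℕ) ≤ B.card * (B.card - 1) := by
  have hinj : Function.Injective fun b => (σ b : ℕ) := Fin.val_injective.comp σ.injective
  have hsub : B.image (fun b => (σ b : ℕ)) ⊆ range B.card := by
    intro r hr
    obtain ⟨b, hb, rfl⟩ := mem_image.mp hr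
    have hIic : (Iic (σ b)).map σ.symm.toEmbedding ⊆ B := by
      intro c hc
      obtain ⟨x, hx, rfl⟩ := mem_map.mp hc
      by_contra hcB
      have := h b hb _ hcB
      rw [Equiv.toEmbedding_apply, Equiv.apply_symm_apply] at this
      exact absurd (mem_Iic.mp hx) (not_le.mpr this)
    have := card_le_card hIic
    rw [card_map, Fin.card_Iic] at this
    exact mem_range.mpr this
  have hsum : ∑ b ∈ B, (σ b : ℕ) = ∑ r ∈ B.image (fun b => (σ b : ℕ)), r :=
    (sum_image (f := fun r : ℕ => r) hinj.injOn).symm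
  have hle := sum_le_sum_of_subset (f := fun r : ℕ => r) hsub
  have := sum_range_id_mul_two B.card
  omega

/-- Averaging over `B`, some member of `B` has a small Dodgson score if a majority of voters give
`B` the top positions. -/
theorem exists_two_mul_dodgsonScore_le (P : Profile m n) {B : Finset (Fin m)}
    (hB : B.Nonempty) (hn : n < 2 * topSupporters P B) :
    ∃ b ∈ B, 2 * dodgsonScore P b ≤ (n / 2 + 1) * (B.card - 1) := by
  obtain ⟨S, hS, hScard⟩ := exists_subset_card_eq (n := n / 2 + 1)
    (show n / 2 + 1 ≤ (univ.filter fun i => ∀ a ∈ B, ∀ b ∉ B, P i a < P i b).card by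
      rw [← topSupporters]; omega)
  refine exists_le_of_sum_le hB ?_
  calc ∑ b ∈ B, 2 * dodgsonScore P b
      ≤ ∑ b ∈ B, 2 * ∑ i ∈ S, (P i b : ℕ) :=
        sum_le_sum fun b _ => Nat.mul_le_mul_left 2 (dodgsonScore_le_sum_rank P b (by omega))
    _ = ∑ i ∈ S, 2 * ∑ b ∈ B, (P i b : ℕ) := by
        simp only [← mul_sum]
        rw [sum_comm]
    _ ≤ S.card • (B.card * (B.card - 1)) :=
        sum_le_card_nsmul _ _ _ fun i hi => two_mul_sum_rank_le _ (mem_filter.mp (hS hi)).2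
    _ = ∑ _b ∈ B, (n / 2 + 1) * (B.card - 1) := by
        rw [sum_const, hScard, smul_eq_mul, smul_eq_mul]
        ring

/-- For all integers `m > k ≥ 1` and every real `q ≥ k/(k+1)`, Dodgson's rule
satisfies the `(q,k,m)`-majority criterion. -/
theorem dodgson_qkm_majority (m k : ℕ) (hk : 1 ≤ k) (hmk : k < m)
    (q : ℝ) (hq : (k : ℝ) / ((k : ℝ) + 1) ≤ q) :
    MajorityCriterion m k q (fun n P => dodgsonWinners P) := by
  intro n hn P B hB hN
  have hkN : k * n < (k + 1) * topSupporters P B := by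
    have hlt : (k : ℝ) / (k + 1) * n < topSupporters P B :=
      (mul_le_mul_of_nonneg_right hq n.cast_nonneg).trans_lt hN
    rw [div_mul_eq_mul_div, div_lt_iff₀ (by positivity), mul_comm (topSupporters P B : ℝ)] at hlt
    exact_mod_cast hlt
  have hmaj : n < 2 * topSupporters P B := by nlinarith
  obtain ⟨b, -, hb⟩ := exists_two_mul_dodgsonScore_le P (card_pos.mp (by omega)) hmaj
  intro a ha
  by_contra haB
  have hab : dodgsonScore P a ≤ dodgsonScore P b := (mem_filter.mp ha).2 b
  have hlow := card_mul_le_dodgsonScore hn P haB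
  rw [hB] at hb hlow
  obtain ⟨j, rfl⟩ := Nat.exists_eq_add_of_le' hk
  rw [Nat.add_sub_cancel] at hb
  have hM : n < 2 * (n / 2 + 1) := by omega
  generalize n / 2 + 1 = M at *
  generalize topSupporters P B = N at *
  have hMN : M * (j + 2) + 2 * (j + 1) * N ≤ 2 * (j + 1) * n := by nlinarith
  have hmul := Nat.mul_le_mul_left (j + 2) hMN
  nlinarith [Nat.mul_le_mul_right ((j + 2) ^ 2) hM.le, Nat.zero_le (n * j ^ 2),
    Nat.mul_lt_mul_of_pos_left hkN (Nat.succ_pos j)]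

end Voting
end
end
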